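/- arXiv:1108.4805 — 3 statements merged into one kernel-verified Lean document; each statement's English description precedes it below -/
import Mathlib

section
/- Let J be a finite nonempty index set and let f_j : ℝⁿ → ℝ be continuously differentiable for each j ∈ J. Define f(x) = max_{j∈J} f_j(x) and the active index set J(x) = {j ∈ J : f_j(x) = f(x)}. Then for every x ∈ ℝⁿ and every direction y ∈ ℝⁿ, the one-sided directional derivative f′(x;y) = lim_{t↓0} (f(x+ty) − f(x))/t exists and equals max_{j∈J(x)} ⟨∇f_j(x), y⟩. -/
open scoped Classical RealInnerProductSpace
open Filter Topology

/-- One-sided directional derivative: `f′(x;y) = lim_{t↓0} (f(x+ty) − f(x))/t = d`. -/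
def HasDirDeriv {n : ℕ} (f : EuclideanSpace ℝ (Fin n) → ℝ)
    (x y : EuclideanSpace ℝ (Fin n)) (d : ℝ) : Prop :=
  Tendsto (fun t : ℝ => (f (x + t • y) - f x) / t) (𝓝[>] (0 : ℝ)) (𝓝 d)

/-- Pointwise maximum of a finite family of functions. -/
noncomputable def fmax {n : ℕ} {J : Type*} [Fintype J] [Nonempty J]
    (f : J → EuclideanSpace ℝ (Fin n) → ℝ) (x : EuclideanSpace ℝ (Fin n)) : ℝ :=
  Finset.univ.sup' Finset.univ_nonempty (fun j => f j x)

/-- The active index set `J(x) = {j ∈ J : f_j(x) = max_{i∈J} f_i(x)}`. -/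
noncomputable def activeSet {n : ℕ} {J : Type*} [Fintype J] [Nonempty J]
    (f : J → EuclideanSpace ℝ (Fin n) → ℝ) (x : EuclideanSpace ℝ (Fin n)) : Finset J :=
  Finset.univ.filter (fun j => f j x = fmax f x)

lemma activeSet_nonempty {n : ℕ} {J : Type*} [Fintype J] [Nonempty J]
    (f : J → EuclideanSpace ℝ (Fin n) → ℝ) (x : EuclideanSpace ℝ (Fin n)) :
    (activeSet f x).Nonempty := by
  obtain ⟨j, -, hj⟩ :=
    Finset.exists_mem_eq_sup' (Finset.univ_nonempty (α := J)) (fun j => f j x)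
  exact ⟨j, Finset.mem_filter.mpr ⟨Finset.mem_univ j, hj.symm⟩⟩

lemma hasDirDeriv_inner_gradient {n : ℕ} {g : EuclideanSpace ℝ (Fin n) → ℝ}
    {x : EuclideanSpace ℝ (Fin n)} (hg : DifferentiableAt ℝ g x)
    (y : EuclideanSpace ℝ (Fin n)) : HasDirDeriv g x y ⟪gradient g x, y⟫ := by
  have h := (hg.hasGradientAt.hasFDerivAt.hasLineDerivAt y).tendsto_slope_zero_right
  simpa [HasDirDeriv, div_eq_inv_mul] using h

/-- Near `x`, only the indices active at `x` contribute to the maximum. -/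
lemma eventually_fmax_eq_sup'_activeSet {n : ℕ} {J : Type*} [Fintype J] [Nonempty J]
    {f : J → EuclideanSpace ℝ (Fin n) → ℝ} {x : EuclideanSpace ℝ (Fin n)}
    (hf : ∀ j, ContinuousAt (f j) x) :
    ∀ᶠ z in 𝓝 x, fmax f z =
      (activeSet f x).sup' (activeSet_nonempty f x) (fun j => f j z) := by
  obtain ⟨i, hi⟩ := activeSet_nonempty f x
  have hix : f i x = fmax f x := (Finset.mem_filter.mp hi).2
  have hlt : ∀ j, ∀ᶠ z in 𝓝 x, j ∉ activeSet f x → f j z < f i z := by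
    intro j
    by_cases hj : j ∈ activeSet f x
    · simp [hj]
    · have hjx : f j x < f i x := by
        rw [hix]
        refine lt_of_le_of_ne (Finset.le_sup' (fun j => f j x) (Finset.mem_univ j)) ?_
        exact fun h => hj (Finset.mem_filter.mpr ⟨Finset.mem_univ j, h⟩)
      filter_upwards [(hf j).eventually_lt (hf i) hjx] with z hz _ using hz
  filter_upwards [eventually_all.mpr hlt] with z hz
  refine le_antisymm (Finset.sup'_le _ _ fun j _ => ?_)
    (Finset.sup'_mono _ (Finset.subset_univ _) _)
  by_cases hj : j ∈ activeSet f x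
  · exact Finset.le_sup' (fun j => f j z) hj
  · exact (hz j hj).le.trans (Finset.le_sup' (fun j => f j z) hi)

/-- for a pointwise maximum `f` of finitely many `C¹` functions, the one-sided
directional derivative at `x` in direction `y` exists and equals
`max_{j ∈ J(x)} ⟨∇f_j(x), y⟩`. -/
theorem max_dirDeriv {n : ℕ} {J : Type*} [Fintype J] [Nonempty J]
    (f : J → EuclideanSpace ℝ (Fin n) → ℝ)
    (hf : ∀ j, ContDiff ℝ 1 (f j))
    (x y : EuclideanSpace ℝ (Fin n)) :
    HasDirDeriv (fmax f) x y
      ((activeSet f x).sup' (activeSet_nonempty f x)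
        (fun j => ⟪gradient (f j) x, y⟫)) := by
  have hd : ∀ j, DifferentiableAt ℝ (f j) x := fun j =>
    (hf j).differentiable one_ne_zero x
  have hlim := Tendsto.finset_sup'_nhds_apply (activeSet_nonempty f x)
    fun j _ => hasDirDeriv_inner_gradient (hd j) y
  refine hlim.congr' ?_
  have hline : Tendsto (fun t : ℝ => x + t • y) (𝓝[>] 0) (𝓝 x) := by
    have hc : Continuous fun t : ℝ => x + t • y := by fun_prop
    simpa using (hc.tendsto 0).mono_left nhdsWithin_le_nhds
  filter_upwards [hline.eventually
    (eventually_fmax_eq_sup'_activeSet fun j => (hd j).continuousAt),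
    self_mem_nhdsWithin] with t ht htpos
  have hmono : Monotone fun a : ℝ => (a - fmax f x) / t := fun a b hab =>
    div_le_div_of_nonneg_right (sub_le_sub_right hab _) (le_of_lt htpos)
  rw [ht, Finset.apply_sup'_eq_sup'_comp (activeSet_nonempty f x)
    (fun a : ℝ => (a - fmax f x) / t) fun a b => hmono.map_sup a b]
  refine Finset.sup'_congr _ rfl fun j hj => ?_
  simp [(Finset.mem_filter.mp hj).2]
end

section
/- Let J and K be finite nonempty index sets and let g_j : ℝⁿ → ℝ (j ∈ J) and h_k : ℝⁿ → ℝ (k ∈ K) be continuously differentiable. Define f(x) = max_{j∈J} g_j(x) − max_{k∈K} h_k(x), and let J(x), K(x) denote the active index sets of the two maxima at x. Then for every x, y ∈ ℝⁿ the one-sided directional derivative f′(x;y) = lim_{t↓0} (f(x+ty) − f(x))/t exists and equals max_{j∈J(x)} ⟨∇g_j(x), y⟩ − max_{k∈K(x)} ⟨∇h_k(x), y⟩. -/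
open scoped Classical RealInnerProductSpace
open Filter Topology

lemma hasDirDeriv_gradient {n : ℕ} {f : EuclideanSpace ℝ (Fin n) → ℝ}
    {x : EuclideanSpace ℝ (Fin n)} (hf : DifferentiableAt ℝ f x)
    (y : EuclideanSpace ℝ (Fin n)) : HasDirDeriv f x y ⟪gradient f x, y⟫ := by
  have hl := (hf.hasGradientAt.hasFDerivAt.hasLineDerivAt y).tendsto_slope_zero_right
  simpa [HasDirDeriv, smul_eq_mul, div_eq_inv_mul] using hl

/-- Danskin's formula for the maximum of a finite family. -/
lemma hasDirDeriv_fmax {n : ℕ} {J : Type*} [Fintype J] [Nonempty J]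
    {f : J → EuclideanSpace ℝ (Fin n) → ℝ} {x y : EuclideanSpace ℝ (Fin n)} {d : J → ℝ}
    (hf : ∀ j, ContinuousAt (f j) x) (hd : ∀ j, HasDirDeriv (f j) x y (d j)) :
    HasDirDeriv (fmax f) x y ((activeSet f x).sup' (activeSet_nonempty f x) d) := by
  have hline : Tendsto (fun t : ℝ => x + t • y) (𝓝[>] 0) (𝓝 x) := by
    have hc : Continuous fun t : ℝ => x + t • y := by fun_prop
    simpa using (hc.tendsto 0).mono_left nhdsWithin_le_nhds
  refine (Tendsto.finset_sup'_nhds_apply (activeSet_nonempty f x) fun j _ => hd j).congr' ?_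
  filter_upwards [hline.eventually (eventually_fmax_eq_sup'_activeSet hf),
    self_mem_nhdsWithin] with t ht ht0
  have hmono : Monotone fun a : ℝ => (a - fmax f x) / t := fun a b hab =>
    div_le_div_of_nonneg_right (sub_le_sub_right hab _) (le_of_lt ht0)
  rw [ht]
  refine Eq.trans (Finset.sup'_congr _ rfl fun j hj => ?_)
    (Finset.apply_sup'_eq_sup'_comp (activeSet_nonempty f x)
      (fun a : ℝ => (a - fmax f x) / t) fun a b => hmono.map_sup a b).symm
  simp only [Function.comp_apply, (Finset.mem_filter.mp hj).2]

/-- for `f = max_j g_j − max_k h_k` with `g_j, h_k` C¹, the one-sided directional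
derivative at `x` in direction `y` exists and equals
`max_{j∈J(x)} ⟨∇g_j(x), y⟩ − max_{k∈K(x)} ⟨∇h_k(x), y⟩`. -/
theorem diffOfMax_dirDeriv {n : ℕ} {J K : Type*} [Fintype J] [Nonempty J]
    [Fintype K] [Nonempty K]
    (g : J → EuclideanSpace ℝ (Fin n) → ℝ) (h : K → EuclideanSpace ℝ (Fin n) → ℝ)
    (hg : ∀ j, ContDiff ℝ 1 (g j)) (hh : ∀ k, ContDiff ℝ 1 (h k))
    (x y : EuclideanSpace ℝ (Fin n)) :
    HasDirDeriv (fun z => fmax g z - fmax h z) x y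
      ((activeSet g x).sup' (activeSet_nonempty g x) (fun j => ⟪gradient (g j) x, y⟫) -
       (activeSet h x).sup' (activeSet_nonempty h x) (fun k => ⟪gradient (h k) x, y⟫)) := by
  have hgd j := (hg j).differentiable one_ne_zero x
  have hhd k := (hh k).differentiable one_ne_zero x
  refine (Tendsto.sub
    (hasDirDeriv_fmax (fun j => (hgd j).continuousAt) fun j => hasDirDeriv_gradient (hgd j) y)
    (hasDirDeriv_fmax (fun k => (hhd k).continuousAt)
      fun k => hasDirDeriv_gradient (hhd k) y)).congr fun t => ?_
  ring
end

section
/- Let α ∈ ℝⁿ, let k ∈ {1, …, n}, and let ε, M > 0 be such that α_i = 0 for all i < k, α_k > ε, and |α_i| < M for all i = k, …, n. Let λ₁, …, λ_n > 0 satisfy λ_{i+1}/λ_i < (ε/M)/(1 + ε/M) for i = 1, …, n−1, and set ȳ = (−λ₁, …, −λ_n). Then ⟨α, ȳ⟩ = −∑_{i=k}^{n} λ_i α_i < 0. -/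
open scoped RealInnerProductSpace
open Filter Topology

/-- If `M λ_{i+1} < ε (λ_i - λ_{i+1})` for all `i`, then every partial sum of `λ_i a_i` starting at
an index `k` with `ε < a_k`, where `|a_i| < M` for `i ≥ k`, exceeds `ε` times its last weight. -/
theorem mul_lt_sum_Icc_of_fast_decay {n : ℕ} (a lam : Fin n → ℝ) (k : Fin n) (ε M : ℝ)
    (hk : ε < a k) (hbound : ∀ i, k ≤ i → |a i| < M) (hlam : ∀ i, 0 < lam i)
    (hdecay : ∀ i : Fin n, ∀ hi : (i : ℕ) + 1 < n,
      M * lam ⟨(i : ℕ) + 1, hi⟩ < ε * (lam i - lam ⟨(i : ℕ) + 1, hi⟩))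
    (m : ℕ) (hkm : (k : ℕ) ≤ m) (hm : m < n) :
    ε * lam ⟨m, hm⟩ < ∑ i ∈ Finset.Icc k ⟨m, hm⟩, lam i * a i := by
  induction m, hkm using Nat.le_induction with
  | base =>
    simp only [Fin.eta, Finset.Icc_self, Finset.sum_singleton]
    nlinarith [hlam k]
  | succ m hkm ih =>
    have hIcc : Finset.Icc k ⟨m + 1, hm⟩ =
        insert ⟨m + 1, hm⟩ (Finset.Icc k ⟨m, Nat.lt_of_succ_lt hm⟩) := by
      ext i
      simp only [Finset.mem_Icc, Finset.mem_insert, Fin.le_def, Fin.ext_iff]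
      omega
    rw [hIcc, Finset.sum_insert (by simp [Fin.le_def])]
    have hprev := ih (Nat.lt_of_succ_lt hm)
    have hstep := hdecay ⟨m, Nat.lt_of_succ_lt hm⟩ hm
    have hlower := (abs_lt.mp (hbound ⟨m + 1, hm⟩ (Fin.le_def.mpr (Nat.le_succ_of_le hkm)))).1
    have hterm := mul_lt_mul_of_pos_left hlower (hlam ⟨m + 1, hm⟩)
    simp only at hstep
    linarith

/-- if `α_i = 0` for `i < k`, `α_k > ε > 0`, `|α_i| < M` for `i ≥ k`, and the
positive weights `λ_i` decrease fast enough (`λ_{i+1}/λ_i < (ε/M)/(1+ε/M)`), then for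
`ȳ = (−λ₁, …, −λ_n)` one has `⟨α, ȳ⟩ = −∑_{i=k}^n λ_i α_i < 0`. -/
theorem inner_neg_of_fast_decay {n : ℕ} (α : EuclideanSpace ℝ (Fin n)) (k : Fin n)
    (ε M : ℝ) (hε : 0 < ε) (hM : 0 < M)
    (hzero : ∀ i < k, α i = 0) (hk : ε < α k)
    (hbound : ∀ i, k ≤ i → |α i| < M)
    (lam : Fin n → ℝ) (hlam : ∀ i, 0 < lam i)
    (hratio : ∀ i : Fin n, ∀ hi : (i : ℕ) + 1 < n,
      lam ⟨(i : ℕ) + 1, hi⟩ / lam i < (ε / M) / (1 + ε / M))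
    (ybar : EuclideanSpace ℝ (Fin n)) (hybar : ∀ i, ybar i = -lam i) :
    ⟪α, ybar⟫ = -∑ i ∈ Finset.univ.filter (fun i => k ≤ i), lam i * α i ∧
      ⟪α, ybar⟫ < 0 := by
  have hinner : ⟪α, ybar⟫ = -∑ i ∈ Finset.univ.filter (fun i => k ≤ i), lam i * α i := by
    rw [PiLp.inner_apply, Finset.sum_filter, ← Finset.sum_neg_distrib]
    refine Finset.sum_congr rfl fun i _ => ?_
    split_ifs with hi
    · simp [hybar]
    · simp [hzero i (not_le.mp hi)]
  refine ⟨hinner, ?_⟩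
  have hdecay : ∀ i : Fin n, ∀ hi : (i : ℕ) + 1 < n,
      M * lam ⟨(i : ℕ) + 1, hi⟩ < ε * (lam i - lam ⟨(i : ℕ) + 1, hi⟩) := by
    intro i hi
    have hr : ε / M / (1 + ε / M) = ε / (M + ε) := by field_simp
    have h := hratio i hi
    rw [hr, div_lt_div_iff₀ (hlam i) (add_pos hM hε)] at h
    linarith
  have hlast : n - 1 < n := Nat.sub_one_lt_of_lt k.isLt
  have hsum := mul_lt_sum_Icc_of_fast_decay (fun i => α i) lam k ε M hk hbound hlam hdecay
    (n - 1) (Nat.le_sub_one_of_lt k.isLt) hlast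
  have hIcc : Finset.univ.filter (fun i => k ≤ i) = Finset.Icc k ⟨n - 1, hlast⟩ := by
    ext i
    simp only [Finset.mem_filter, Finset.mem_univ, true_and, Finset.mem_Icc, Fin.le_def]
    omega
  rw [hinner, hIcc, neg_lt_zero]
  exact (mul_pos hε (hlam _)).trans hsum
end
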